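/- arXiv:2403.17480 — 3 statements merged into one kernel-verified Lean document; each statement's English description precedes it below -/
import Mathlib

section
/- Let 0 < α ≤ 1. For every arrival sequence a and every feasible schedule s', the schedule A_f produced by the online algorithm that sets s(t) = n(t) (serve every outstanding job) satisfies C(A_f) ≤ 2·C(s'); i.e., the algorithm s(t) = n(t) is 2-competitive for flow time plus linear switching cost. -/
open scoped BigOperators ENNReal

/-- Cumulative arrivals up to and including slot `t`. -/
def cumA (a : ℕ → ℕ) (t : ℕ) : ℕ := ∑ τ ∈ Finset.range (t + 1), a τ

/-- Cumulative service strictly before slot `t`. -/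
def cumS (s : ℕ → ℕ) (t : ℕ) : ℕ := ∑ τ ∈ Finset.range t, s τ

/-- Backlog (number of outstanding unit-size jobs) of schedule `s` at slot `t`. -/
def backlog (a s : ℕ → ℕ) (t : ℕ) : ℕ := cumA a t - cumS s t

/-- A schedule is feasible if it never serves more jobs than are outstanding. -/
def Feasible (a s : ℕ → ℕ) : Prop := ∀ t, s t ≤ backlog a s t

/-- Finite support of the arrival sequence. -/
def FinSupp (a : ℕ → ℕ) : Prop := ∃ T, ∀ t, T < t → a t = 0

/-- `s (t-1)` with the convention `s (-1) = 0`. -/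
def sPrev (s : ℕ → ℕ) : ℕ → ℕ
  | 0 => 0
  | t + 1 => s t

/-- Flow time plus linear switching cost, with weight `α`. -/
noncomputable def costLin (α : ℝ) (a s : ℕ → ℕ) : ℝ≥0∞ :=
  (∑' t, (backlog a s t : ℝ≥0∞)) +
    ENNReal.ofReal α * ∑' t, (((s t : ℤ) - (sPrev s t : ℤ)).natAbs : ℝ≥0∞)

/-- Flow time plus quadratic switching cost, with weight `α`. -/
noncomputable def costQuad (α : ℝ) (a s : ℕ → ℕ) : ℝ≥0∞ :=
  (∑' t, (backlog a s t : ℝ≥0∞)) +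
    ENNReal.ofReal α * ∑' t, ((((s t : ℤ) - (sPrev s t : ℤ)).natAbs ^ 2 : ℕ) : ℝ≥0∞)

/-- State machine of an online algorithm: the state at slot `t` is the pair
`(backlog at t, number of active servers at t)`, where the number of active
servers is `g` applied to the current backlog and the previous action
(with the convention that the action at slot `-1` is `0`). -/
def algState (a : ℕ → ℕ) (g : ℕ → ℕ → ℕ) : ℕ → ℕ × ℕ
  | 0 => (a 0, g (a 0) 0)
  | t + 1 =>
      let p := algState a g t
      let n := p.1 - p.2 + a (t + 1)
      (n, g n p.2)

/-- The schedule produced by the online rule `g` on arrival sequence `a`. -/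
def algSched (a : ℕ → ℕ) (g : ℕ → ℕ → ℕ) (t : ℕ) : ℕ := (algState a g t).2

/-- The algorithm `s(t) = n(t)` serves each job in its arrival slot. -/
lemma algState_serve_all (a : ℕ → ℕ) (t : ℕ) :
    algState a (fun n _ => n) t = (a t, a t) := by
  induction t with
  | zero => rfl
  | succ t ih => simp [algState, ih]

lemma algSched_serve_all (a : ℕ → ℕ) : algSched a (fun n _ => n) = a := by
  funext t
  simp [algSched, algState_serve_all]

lemma backlog_self (a : ℕ → ℕ) (t : ℕ) : backlog a a t = a t := by
  simp [backlog, cumA, cumS, Finset.sum_range_succ]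

lemma cumA_succ (a : ℕ → ℕ) (t : ℕ) : cumA a (t + 1) = cumA a t + a (t + 1) :=
  Finset.sum_range_succ _ _

lemma cumS_succ (s : ℕ → ℕ) (t : ℕ) : cumS s (t + 1) = cumS s t + s t :=
  Finset.sum_range_succ _ _

lemma Feasible.cumS_le_cumA {a s : ℕ → ℕ} (hs : Feasible a s) (t : ℕ) :
    cumS s t ≤ cumA a t := by
  induction t with
  | zero => simp [cumS]
  | succ t ih =>
    have h := hs t
    rw [backlog] at h
    rw [cumS_succ, cumA_succ]
    omega

/-- The backlog consists of the new arrivals and the jobs left over from the previous slot. -/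
lemma Feasible.backlog_eq {a s : ℕ → ℕ} (hs : Feasible a s) (t : ℕ) :
    backlog a s t = a t + sPrev (fun t => backlog a s t - s t) t := by
  cases t with
  | zero => simp [backlog, cumA, cumS, sPrev]
  | succ t =>
    have h := hs t
    have h' := hs.cumS_le_cumA t
    simp only [sPrev, backlog, cumS_succ, cumA_succ] at *
    omega

lemma tsum_sPrev (f : ℕ → ℕ) : ∑' t, (sPrev f t : ℝ≥0∞) = ∑' t, (f t : ℝ≥0∞) := by
  rw [tsum_eq_zero_add' ENNReal.summable]
  simp [sPrev]

/-- If `a` and `s` differ by the discrete derivative of `e`, the jumps of `a` are controlled by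
those of `s` and by the values of `a` and `e`. -/
lemma two_mul_natAbs_sub_sPrev_le {a s e : ℕ → ℕ} (h : ∀ t, a t + sPrev e t = s t + e t)
    (t : ℕ) :
    2 * ((a t : ℤ) - (sPrev a t : ℤ)).natAbs ≤
      a t + sPrev a t + ((s t : ℤ) - (sPrev s t : ℤ)).natAbs +
        (e t + 2 * sPrev e t + sPrev (sPrev e) t) := by
  cases t with
  | zero =>
    have h0 := h 0
    simp only [sPrev] at *
    omega
  | succ t =>
    have h0 := h t
    have h1 := h (t + 1)
    simp only [sPrev] at *
    omega

lemma two_mul_tsum_natAbs_sub_sPrev_le {a s e : ℕ → ℕ}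
    (h : ∀ t, a t + sPrev e t = s t + e t) :
    2 * ∑' t, (((a t : ℤ) - (sPrev a t : ℤ)).natAbs : ℝ≥0∞) ≤
      2 * ∑' t, (a t : ℝ≥0∞) + ∑' t, (((s t : ℤ) - (sPrev s t : ℤ)).natAbs : ℝ≥0∞) +
        4 * ∑' t, (e t : ℝ≥0∞) := by
  calc 2 * ∑' t, (((a t : ℤ) - (sPrev a t : ℤ)).natAbs : ℝ≥0∞)
      = ∑' t, 2 * (((a t : ℤ) - (sPrev a t : ℤ)).natAbs : ℝ≥0∞) := ENNReal.tsum_mul_left.symm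
    _ ≤ ∑' t, ((a t : ℝ≥0∞) + sPrev a t + ((s t : ℤ) - (sPrev s t : ℤ)).natAbs +
          (e t + 2 * sPrev e t + sPrev (sPrev e) t)) :=
        ENNReal.tsum_le_tsum fun t => by exact_mod_cast two_mul_natAbs_sub_sPrev_le h t
    _ = _ := by
        simp only [ENNReal.tsum_add, ENNReal.tsum_mul_left, tsum_sPrev]
        ring

/-- For `0 < α ≤ 1`, the online algorithm `A_f` that sets
`s(t) = n(t)` is 2-competitive for flow time plus linear switching cost. -/
theorem Af_two_competitive (α : ℝ) (hα0 : 0 < α) (hα1 : α ≤ 1)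
    (a : ℕ → ℕ) (ha : FinSupp a)
    (s' : ℕ → ℕ) (hs' : Feasible a s') :
    costLin α a (algSched a (fun n _ => n)) ≤ 2 * costLin α a s' := by
  have hsplit := hs'.backlog_eq
  set e : ℕ → ℕ := fun t => backlog a s' t - s' t with he
  have hae : ∀ t, a t + sPrev e t = s' t + e t := fun t => by
    have h1 := hs' t
    have h2 := hsplit t
    simp only [he] at *
    omega
  have hTV := two_mul_tsum_natAbs_sub_sPrev_le hae
  have hflow : ∑' t, (backlog a s' t : ℝ≥0∞) = ∑' t, (a t : ℝ≥0∞) + ∑' t, (e t : ℝ≥0∞) := by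
    rw [← tsum_sPrev e, ← ENNReal.tsum_add]
    exact tsum_congr fun t => by exact_mod_cast hsplit t
  have hα : ENNReal.ofReal α ≤ 1 := ENNReal.ofReal_le_one.2 hα1
  simp only [algSched_serve_all, costLin, backlog_self, hflow]
  generalize ENNReal.ofReal α = β at *
  generalize ∑' t, (((a t : ℤ) - (sPrev a t : ℤ)).natAbs : ℝ≥0∞) = V at *
  generalize ∑' t, (((s' t : ℤ) - (sPrev s' t : ℤ)).natAbs : ℝ≥0∞) = W at *
  generalize ∑' t, (a t : ℝ≥0∞) = N at *
  generalize ∑' t, (e t : ℝ≥0∞) = E at *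
  have hV : V ≤ N + 2 * W + 2 * E := by
    refine (ENNReal.mul_le_mul_iff_right two_ne_zero ENNReal.ofNat_ne_top).1 (hTV.trans ?_)
    calc 2 * N + W + 4 * E ≤ 2 * N + 4 * W + 4 * E := by
          gcongr
          exact le_mul_of_one_le_left' (by norm_num)
      _ = 2 * (N + 2 * W + 2 * E) := by ring
  calc N + β * V ≤ N + β * (N + 2 * W + 2 * E) := by gcongr
    _ = N + (β * (N + 2 * E) + 2 * (β * W)) := by ring
    _ ≤ N + (1 * (N + 2 * E) + 2 * (β * W)) := by gcongr
    _ = 2 * (N + E + β * W) := by ring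
end

section
/- The balancing algorithm A_bal-2, which increases the number of active servers by ⌈n(t)/α⌉ each slot, i.e., s(t) = min{n(t), s(t−1) + ⌈n(t)/α⌉}, has unbounded competitive ratio for flow time plus linear switching cost: for every M > 0 there exist a weight α > 1, an arrival sequence a, and a feasible schedule s' such that C(A_bal-2) ≥ M·C(s'). In particular, for the instance where N jobs arrive at time 0 (and none later) and α = N², A_bal-2 has switching cost Ω(N^{5/2}), while the schedule that runs ⌈N/√α⌉ servers until the work is exhausted has cost O(N²). -/
open scoped BigOperators ENNReal

/-- The balancing rule of `A_bal-2`: `s(t) = min {n(t), s(t-1) + ⌈n(t)/α⌉}`. -/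
noncomputable def bal2Rule (α : ℝ) : ℕ → ℕ → ℕ := fun n p => min n (p + ⌈(n : ℝ) / α⌉₊)

/-- The instance in which `N` jobs arrive at slot `0` and none later. -/
def burst (N : ℕ) : ℕ → ℕ := fun t => if t = 0 then N else 0

lemma finSupp_burst (N : ℕ) : FinSupp (burst N) :=
  ⟨0, fun t ht => by simp [burst, ht.ne']⟩

section OnlineRule

variable {a : ℕ → ℕ} {g : ℕ → ℕ → ℕ}

lemma algState_snd_le_fst (hg : ∀ n p, g n p ≤ n) (t : ℕ) :
    (algState a g t).2 ≤ (algState a g t).1 := by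
  cases t <;> exact hg _ _

lemma cumS_add_algState_fst (hg : ∀ n p, g n p ≤ n) (t : ℕ) :
    cumS (algSched a g) t + (algState a g t).1 = cumA a t := by
  induction t with
  | zero => simp [cumS, cumA, algState]
  | succ t ih =>
    have hle := algState_snd_le_fst (a := a) hg t
    have hS : cumS (algSched a g) (t + 1) = cumS (algSched a g) t + (algState a g t).2 :=
      Finset.sum_range_succ _ _
    have hA : cumA a (t + 1) = cumA a t + a (t + 1) := Finset.sum_range_succ _ _
    have hn : (algState a g (t + 1)).1 =
        (algState a g t).1 - (algState a g t).2 + a (t + 1) := rfl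
    omega

lemma backlog_algSched (hg : ∀ n p, g n p ≤ n) (t : ℕ) :
    backlog a (algSched a g) t = (algState a g t).1 := by
  have := cumS_add_algState_fst (a := a) hg t
  unfold backlog
  omega

lemma feasible_algSched (hg : ∀ n p, g n p ≤ n) : Feasible a (algSched a g) := fun t => by
  rw [backlog_algSched hg]
  exact algState_snd_le_fst hg t

end OnlineRule

lemma le_sum_natAbs_sub_sPrev (s : ℕ → ℕ) (t : ℕ) :
    s t ≤ ∑ i ∈ Finset.range (t + 1), ((s i : ℤ) - (sPrev s i : ℤ)).natAbs := by
  induction t with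
  | zero => simp [sPrev]
  | succ t ih =>
    have hprev : sPrev s (t + 1) = s t := rfl
    rw [Finset.sum_range_succ, hprev]
    omega

lemma le_tsum_natAbs_sub_sPrev (s : ℕ → ℕ) (t : ℕ) :
    (s t : ℝ≥0∞) ≤ ∑' i, (((s i : ℤ) - (sPrev s i : ℤ)).natAbs : ℝ≥0∞) := by
  refine le_trans ?_ (ENNReal.sum_le_tsum (Finset.range (t + 1)))
  exact_mod_cast le_sum_natAbs_sub_sPrev s t

lemma algState_burst_single_server (N t : ℕ) :
    algState (burst N) (fun n _ => min n 1) t = (N - t, min (N - t) 1) := by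
  induction t with
  | zero => simp [algState, burst]
  | succ t ih =>
    have h : N - t - min (N - t) 1 + burst N (t + 1) = N - (t + 1) := by
      simp only [burst, Nat.add_eq_zero_iff, one_ne_zero, and_false, if_false]
      omega
    simp only [algState, ih, h]

lemma costLin_burst_single_server_le (N : ℕ) :
    costLin ((N : ℝ) ^ 2) (burst N) (algSched (burst N) (fun n _ => min n 1)) ≤
      ENNReal.ofReal (3 * (N : ℝ) ^ 2) := by
  have hflow : ∑' t, (backlog (burst N) (algSched (burst N) (fun n _ => min n 1)) t : ℝ≥0∞) ≤
      (N : ℝ≥0∞) ^ 2 := by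
    simp_rw [backlog_algSched (g := fun n _ => min n 1) (fun n _ => min_le_left n 1),
      algState_burst_single_server]
    rw [tsum_eq_sum (s := Finset.range N)]
    · have : ∑ t ∈ Finset.range N, (N - t) ≤ N ^ 2 := by
        calc ∑ t ∈ Finset.range N, (N - t) ≤ ∑ _t ∈ Finset.range N, N :=
              Finset.sum_le_sum fun t _ => Nat.sub_le N t
          _ = N ^ 2 := by simp [sq]
      exact_mod_cast this
    · intro t ht
      have : N - t = 0 := by simpa [Nat.sub_eq_zero_iff_le] using ht
      simp [this]
  have hswitch : ∑' t, (((algSched (burst N) (fun n _ => min n 1) t : ℤ) -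
      (sPrev (algSched (burst N) (fun n _ => min n 1)) t : ℤ)).natAbs : ℝ≥0∞) ≤ 2 := by
    calc _ ≤ ∑' t : ℕ, ((if t = 0 then 1 else 0) + (if t = N then 1 else 0) : ℝ≥0∞) := by
          refine ENNReal.tsum_le_tsum fun t => ?_
          have : (((algSched (burst N) (fun n _ => min n 1) t : ℤ) -
              (sPrev (algSched (burst N) (fun n _ => min n 1)) t : ℤ)).natAbs) ≤
              (if t = 0 then 1 else 0) + (if t = N then 1 else 0) := by
            cases t with
            | zero =>
              simp only [algSched, sPrev, algState_burst_single_server]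
              split_ifs <;> omega
            | succ t =>
              simp only [algSched, sPrev, algState_burst_single_server]
              split_ifs <;> omega
          exact_mod_cast this
      _ = 2 := by
          rw [ENNReal.tsum_add, tsum_ite_eq, tsum_ite_eq, one_add_one_eq_two]
  have hα : ENNReal.ofReal ((N : ℝ) ^ 2) = (N : ℝ≥0∞) ^ 2 := by
    rw [ENNReal.ofReal_pow (Nat.cast_nonneg N), ENNReal.ofReal_natCast]
  calc _ ≤ (N : ℝ≥0∞) ^ 2 + (N : ℝ≥0∞) ^ 2 * 2 := by
        unfold costLin
        rw [hα]
        gcongr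
    _ = ENNReal.ofReal (3 * (N : ℝ) ^ 2) := by
        rw [ENNReal.ofReal_mul (by norm_num), hα, ENNReal.ofReal_ofNat]
        ring

lemma algState_burst_bal2Rule {N t : ℕ} (ht : (t + 1) * (t + 2) ≤ 2 * N) :
    2 * (algState (burst N) (bal2Rule ((N : ℝ) ^ 2)) t).1 + t * (t + 1) = 2 * N ∧
      (algState (burst N) (bal2Rule ((N : ℝ) ^ 2)) t).2 = t + 1 := by
  have hceil : ∀ n : ℕ, 0 < n → n ≤ N → ⌈(n : ℝ) / (N : ℝ) ^ 2⌉₊ = 1 := by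
    intro n hn hnN
    have hN : 0 < N := hn.trans_le hnN
    have hle : (n : ℝ) ≤ (N : ℝ) ^ 2 := by
      exact_mod_cast hnN.trans (Nat.le_self_pow two_ne_zero N)
    apply le_antisymm
    · rw [Nat.ceil_le, Nat.cast_one]
      exact div_le_one_of_le₀ hle (by positivity)
    · exact Nat.one_le_ceil_iff.2 (by positivity)
  induction t with
  | zero =>
    have hN : 0 < N := by omega
    simp only [algState, burst, bal2Rule, if_true, hceil N hN le_rfl]
    omega
  | succ t ih =>
    obtain ⟨h₁, h₂⟩ := ih (by nlinarith)
    have hn : (algState (burst N) (bal2Rule ((N : ℝ) ^ 2)) (t + 1)).1 =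
        (algState (burst N) (bal2Rule ((N : ℝ) ^ 2)) t).1 - (t + 1) := by
      simp [algState, burst, h₂]
    have hs : (algState (burst N) (bal2Rule ((N : ℝ) ^ 2)) (t + 1)).2 =
        bal2Rule ((N : ℝ) ^ 2) (algState (burst N) (bal2Rule ((N : ℝ) ^ 2)) (t + 1)).1
          (t + 1) :=
      congrArg (bal2Rule ((N : ℝ) ^ 2) _) h₂
    have hsum : 2 * (algState (burst N) (bal2Rule ((N : ℝ) ^ 2)) (t + 1)).1 +
        (t + 1) * (t + 1 + 1) = 2 * N := by
      have : t + 1 ≤ (algState (burst N) (bal2Rule ((N : ℝ) ^ 2)) t).1 := by nlinarith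
      rw [hn]
      zify [this] at h₁ ⊢
      linarith
    refine ⟨hsum, ?_⟩
    have hlow : t + 2 ≤ (algState (burst N) (bal2Rule ((N : ℝ) ^ 2)) (t + 1)).1 := by
      nlinarith
    rw [hs, bal2Rule, hceil _ (by omega) (by nlinarith)]
    omega

lemma rpow_five_halves {x : ℝ} (hx : 0 < x) : x ^ ((5 : ℝ) / 2) = x ^ 2 * √x := by
  rw [Real.sqrt_eq_rpow, ← Real.rpow_natCast, ← Real.rpow_add hx]
  norm_num

lemma ofReal_le_switching_bal2 {N : ℕ} (hN : 1 ≤ N) :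
    ENNReal.ofReal (1 / 2 * (N : ℝ) ^ ((5 : ℝ) / 2)) ≤
      ENNReal.ofReal ((N : ℝ) ^ 2) *
        ∑' t, (((algSched (burst N) (bal2Rule ((N : ℝ) ^ 2)) t : ℤ) -
          (sPrev (algSched (burst N) (bal2Rule ((N : ℝ) ^ 2))) t : ℤ)).natAbs : ℝ≥0∞) := by
  obtain ⟨k, hk⟩ : ∃ k, N.sqrt = k + 1 :=
    Nat.exists_eq_succ_of_ne_zero (Nat.sqrt_pos.2 hN).ne'
  have hle : (k + 1) * (k + 1) ≤ N := hk ▸ Nat.sqrt_le N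
  have hlt : N < (k + 2) * (k + 2) := by
    have := Nat.lt_succ_sqrt N
    rwa [hk] at this
  have hserv : algSched (burst N) (bal2Rule ((N : ℝ) ^ 2)) k = k + 1 :=
    (algState_burst_bal2Rule (by nlinarith)).2
  have hsqrt : 1 / 2 * √(N : ℝ) ≤ ((k + 1 : ℕ) : ℝ) := by
    have : √(N : ℝ) ≤ k + 2 := by
      apply Real.sqrt_le_iff.2 ⟨by positivity, ?_⟩
      have : (N : ℝ) < (k + 2) * (k + 2) := by exact_mod_cast hlt
      nlinarith
    push_cast
    linarith [(Nat.cast_nonneg k : (0 : ℝ) ≤ k)]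
  have hpos : (0 : ℝ) < N := by exact_mod_cast hN
  calc ENNReal.ofReal (1 / 2 * (N : ℝ) ^ ((5 : ℝ) / 2))
      = ENNReal.ofReal ((N : ℝ) ^ 2) * ENNReal.ofReal (1 / 2 * √(N : ℝ)) := by
        rw [← ENNReal.ofReal_mul (by positivity), rpow_five_halves hpos]
        ring_nf
    _ ≤ ENNReal.ofReal ((N : ℝ) ^ 2) * ((k + 1 : ℕ) : ℝ≥0∞) := by
        gcongr
        rw [← ENNReal.ofReal_natCast]
        exact ENNReal.ofReal_le_ofReal hsqrt
    _ ≤ _ := by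
        gcongr
        exact hserv ▸ le_tsum_natAbs_sub_sPrev _ k

/-- `A_bal-2` has unbounded competitive ratio for flow time plus
linear switching cost; in particular on the instance with `N` jobs at time `0`
and `α = N²` its (weighted) switching cost is `Ω(N^{5/2})`, while the schedule
running `⌈N/√α⌉` servers until the work is exhausted pays `O(N²)`. -/
theorem bal2_unbounded :
    (∀ M : ℝ, 0 < M → ∃ (α : ℝ) (a s' : ℕ → ℕ), 1 < α ∧ FinSupp a ∧ Feasible a s' ∧
      ENNReal.ofReal M * costLin α a s' ≤ costLin α a (algSched a (bal2Rule α))) ∧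
    (∃ c₁ c₂ : ℝ, 0 < c₁ ∧ 0 < c₂ ∧ ∃ N₀ : ℕ, ∀ N : ℕ, N₀ ≤ N →
      ∀ a s' sb : ℕ → ℕ,
        a = (fun t => if t = 0 then N else 0) →
        sb = algSched a (bal2Rule ((N : ℝ) ^ 2)) →
        s' = algSched a (fun n _ => min n ⌈(N : ℝ) / Real.sqrt ((N : ℝ) ^ 2)⌉₊) →
        ENNReal.ofReal (c₁ * (N : ℝ) ^ ((5 : ℝ) / 2)) ≤
          ENNReal.ofReal ((N : ℝ) ^ 2) *
            ∑' t, (((sb t : ℤ) - (sPrev sb t : ℤ)).natAbs : ℝ≥0∞) ∧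
        Feasible a s' ∧
        costLin ((N : ℝ) ^ 2) a s' ≤ ENNReal.ofReal (c₂ * (N : ℝ) ^ 2)) := by
  refine ⟨fun M hM => ?_, 1 / 2, 3, by norm_num, by norm_num, 1, ?_⟩
  · obtain ⟨N, hN⟩ := exists_nat_ge (max 2 ((6 * M) ^ 2))
    have hN2 : (2 : ℝ) ≤ N := (le_max_left _ _).trans hN
    have hN1 : 1 ≤ N := by
      have : 2 ≤ N := by exact_mod_cast hN2
      omega
    have hM6 : 6 * M ≤ √(N : ℝ) := Real.le_sqrt_of_sq_le ((le_max_right _ _).trans hN)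
    refine ⟨(N : ℝ) ^ 2, burst N, algSched (burst N) (fun n _ => min n 1), by nlinarith,
      finSupp_burst N, feasible_algSched fun n _ => min_le_left n 1, ?_⟩
    calc _ ≤ ENNReal.ofReal M * ENNReal.ofReal (3 * (N : ℝ) ^ 2) := by
          gcongr
          exact costLin_burst_single_server_le N
      _ ≤ ENNReal.ofReal (1 / 2 * (N : ℝ) ^ ((5 : ℝ) / 2)) := by
          rw [← ENNReal.ofReal_mul hM.le, rpow_five_halves (by linarith)]
          apply ENNReal.ofReal_le_ofReal
          nlinarith [mul_le_mul_of_nonneg_left hM6 (sq_nonneg (N : ℝ))]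
      _ ≤ _ := (ofReal_le_switching_bal2 hN1).trans le_add_self
  · rintro N hN a s' sb rfl rfl rfl
    have hceil : ⌈(N : ℝ) / √((N : ℝ) ^ 2)⌉₊ = 1 := by
      have : (N : ℝ) ≠ 0 := by
        exact_mod_cast (Nat.one_le_iff_ne_zero.1 hN)
      rw [Real.sqrt_sq (Nat.cast_nonneg N), div_self this, Nat.ceil_one]
    rw [hceil]
    exact ⟨ofReal_le_switching_bal2 hN, feasible_algSched fun n _ => min_le_left n 1,
      costLin_burst_single_server_le N⟩
end

section
/- Suppose n₀ unit-size jobs are present at time 0 and no further jobs arrive, and let α ≥ 1 and β ≥ 1. Define the backlog recursion n(0) = n₀ and n(t+1) = n(t) − s(t) with s(t) = min{n(t), ⌈β·√(n(t)/α)⌉} (the alg dynamics). If β·√(n₀/α) ≤ n₀, then all jobs are finished by time 3√(α·n₀)/β, i.e., n(t) = 0 for every natural number t ≥ 3√(α·n₀)/β; otherwise (when β·√(n₀/α) > n₀) all jobs are finished in one slot, i.e., n(1) = 0. -/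
/-- While the backlog is nonzero, its square root decreases by at least `c / 2` in every slot. -/
lemma backlog_eq_zero_or_sqrt_le {c : ℝ} (hc : 0 < c) {n : ℕ → ℕ}
    (hn : ∀ t, n (t + 1) = n t - min (n t) ⌈c * Real.sqrt (n t)⌉₊) (t : ℕ) :
    n t = 0 ∨ Real.sqrt (n t) + t * (c / 2) ≤ Real.sqrt (n 0) := by
  induction t with
  | zero => simp
  | succ t ih =>
    refine or_iff_not_imp_left.2 fun hpos => ?_
    have hstep := hn t
    have hlt : ⌈c * Real.sqrt (n t)⌉₊ < n t := by omega
    have heq : n (t + 1) + ⌈c * Real.sqrt (n t)⌉₊ = n t := by omega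
    have ih' := ih.resolve_left (by omega)
    have hceil := Nat.le_ceil (c * Real.sqrt (n t))
    have heq' : (n (t + 1) : ℝ) + (⌈c * Real.sqrt (n t)⌉₊ : ℝ) = n t := by exact_mod_cast heq
    have hlt' : (⌈c * Real.sqrt (n t)⌉₊ : ℝ) < n t := by exact_mod_cast hlt
    have hsq : Real.sqrt (n t) ^ 2 = n t := Real.sq_sqrt (Nat.cast_nonneg _)
    have hcs : c < Real.sqrt (n t) := by
      by_contra! h
      nlinarith [mul_le_mul_of_nonneg_right h (Real.sqrt_nonneg (n t))]
    have hdec : Real.sqrt (n (t + 1)) ≤ Real.sqrt (n t) - c / 2 :=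
      Real.sqrt_le_iff.2 ⟨by linarith, by nlinarith⟩
    push_cast
    linarith


/-- with `n₀` unit-size jobs at time `0`, no further arrivals,
`α ≥ 1` and `β ≥ 1`, the `alg` backlog recursion
`n(t+1) = n(t) − min {n(t), ⌈β·√(n(t)/α)⌉}` empties by time `3√(α·n₀)/β` when
`β·√(n₀/α) ≤ n₀`, and in one slot otherwise. -/
theorem alg_completion_time (α β : ℝ) (hα : 1 ≤ α) (hβ : 1 ≤ β) (n₀ : ℕ)
    (nrec : ℕ → ℕ)
    (h0 : nrec 0 = n₀)
    (hrec : ∀ t : ℕ,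
      nrec (t + 1) = nrec t - min (nrec t) ⌈β * Real.sqrt ((nrec t : ℝ) / α)⌉₊) :
    (β * Real.sqrt ((n₀ : ℝ) / α) ≤ (n₀ : ℝ) →
      ∀ t : ℕ, 3 * Real.sqrt (α * (n₀ : ℝ)) / β ≤ (t : ℝ) → nrec t = 0) ∧
    ((n₀ : ℝ) < β * Real.sqrt ((n₀ : ℝ) / α) → nrec 1 = 0) := by
  have hα' : 0 < Real.sqrt α := Real.sqrt_pos.2 (by linarith)
  have hc : 0 < β / Real.sqrt α := by positivity
  refine ⟨fun _ t ht => ?_, fun h => ?_⟩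
  · have hn : ∀ t, nrec (t + 1) =
        nrec t - min (nrec t) ⌈β / Real.sqrt α * Real.sqrt (nrec t)⌉₊ := by
      intro t
      rw [hrec t, Real.sqrt_div (Nat.cast_nonneg _), mul_div_assoc', div_mul_eq_mul_div]
    refine (backlog_eq_zero_or_sqrt_le hc hn t).elim id fun hle => ?_
    have ht' : 3 * Real.sqrt n₀ ≤ t * (β / Real.sqrt α) := by
      rw [Real.sqrt_mul (by linarith), div_le_iff₀ (by linarith)] at ht
      rw [mul_div_assoc', le_div_iff₀ hα']
      linarith
    rw [h0] at hle
    have hsqrt : Real.sqrt (nrec t) ≤ 0 := by linarith [Real.sqrt_nonneg (n₀ : ℝ)]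
    exact_mod_cast (Real.sqrt_eq_zero (Nat.cast_nonneg _)).1
      (le_antisymm hsqrt (Real.sqrt_nonneg _))
  · have hle : n₀ ≤ ⌈β * Real.sqrt ((n₀ : ℝ) / α)⌉₊ := by
      exact_mod_cast h.le.trans (Nat.le_ceil _)
    have hstep := hrec 0
    rw [h0, min_eq_left hle] at hstep
    simpa using hstep
end
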